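/- Let a, k : ℕ → ℕ with a(n) ≥ 1 for all n, a(n) = o(√n) and k(n) = o(n) as n → ∞, let ε > 0, and set h(n) = ⌈ n / ( 2·(a(n) + ln n) ) ⌉. Then for all sufficiently large n one has h(n) − a(n) > a(n) and (1+ε)·a(n)·n/(a(n) + ln n) ≥ ( a(n)·( n − k(n) − h(n) + ln⌈(h(n)−a(n))/a(n)⌉ ) + ln⌈(h(n)−a(n))/a(n)⌉ − 1 + a(n)/(h(n)−a(n)) ) / ( a(n) + ln⌈(h(n)−a(n))/a(n)⌉ − 1 + a(n)/(h(n)−a(n)) ). -/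

import Mathlib

open Filter Real

/-- The target clique size `h(n) = ⌈n / (2(a(n) + ln n))⌉` from Theorem 2.17. -/
noncomputable def cliqueSize (a : ℕ → ℕ) (n : ℕ) : ℕ :=
  ⌈(n : ℝ) / (2 * ((a n : ℝ) + Real.log n))⌉₊

/-- Final inequality in the proof of Theorem 2.17, verifying the sufficient
condition for BoxMaker's win in the auxiliary Box game
`B(h−a, (h−a)(n−k−h+1), b, a)` with `b = (1+ε)·a·n/(a+ln n)`. -/
theorem stmt14 (a k : ℕ → ℕ) (ha1 : ∀ n, 1 ≤ a n)
    (ha : (fun n : ℕ => (a n : ℝ)) =o[atTop] fun n : ℕ => Real.sqrt n)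
    (hk : (fun n : ℕ => (k n : ℝ)) =o[atTop] fun n : ℕ => (n : ℝ))
    (ε : ℝ) (hε : 0 < ε) :
    ∀ᶠ n : ℕ in atTop,
      a n < cliqueSize a n - a n ∧
      (1 + ε) * a n * n / (a n + Real.log n) ≥
        ((a n : ℝ) * ((n : ℝ) - k n - cliqueSize a n
              + Real.log (⌈((cliqueSize a n - a n : ℕ) : ℝ) / (a n : ℝ)⌉₊ : ℝ))
            + Real.log (⌈((cliqueSize a n - a n : ℕ) : ℝ) / (a n : ℝ)⌉₊ : ℝ) - 1
            + (a n : ℝ) / ((cliqueSize a n : ℝ) - a n))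
          / ((a n : ℝ) + Real.log (⌈((cliqueSize a n - a n : ℕ) : ℝ) / (a n : ℝ)⌉₊ : ℝ) - 1
            + (a n : ℝ) / ((cliqueSize a n : ℝ) - a n)) := by
  obtain ⟨δ, hδ0, hδ1⟩ : ∃ δ : ℝ, 0 < δ ∧ 1 + δ ≤ (1 + ε) * (1 - δ) := by
    refine ⟨ε / (2 + ε), by positivity, ?_⟩
    apply le_of_eq
    field_simp
    ring
  have hδlt : δ < 1 := by
    by_contra hcon
    push Not at hcon
    nlinarith
  have hL : Tendsto (fun n : ℕ => Real.log (n : ℝ)) atTop atTop :=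
    Real.tendsto_log_atTop.comp tendsto_natCast_atTop_atTop
  have hS : Tendsto (fun n : ℕ => (a n : ℝ) + Real.log (n : ℝ)) atTop atTop :=
    tendsto_atTop_mono (fun n => by
      have : (0 : ℝ) ≤ a n := Nat.cast_nonneg _
      linarith) hL
  have hx : ∀ᶠ x : ℝ in atTop, Real.log (4 * x ^ 2) + 1 ≤ δ * x := by
    have h1 := Real.isLittleO_log_id_atTop.bound (show 0 < δ / 4 by positivity)
    filter_upwards [h1, eventually_gt_atTop 1,
      eventually_ge_atTop ((Real.log 4 + 1) / (δ / 2))] with x hx1 hx2 hx3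
    rw [div_le_iff₀ (by positivity)] at hx3
    rw [Real.log_mul (by norm_num) (by positivity), Real.log_pow]
    simp only [id, Real.norm_eq_abs] at hx1
    rw [abs_of_pos (by linarith : 0 < x)] at hx1
    have := le_abs_self (Real.log x)
    push_cast
    linarith
  have hE2 : ∀ᶠ n : ℕ in atTop, Real.log (n : ℝ) ≤ δ / 2 * n := by
    have h1 := Real.isLittleO_log_id_atTop.bound (show 0 < δ / 2 by positivity)
    filter_upwards [tendsto_natCast_atTop_atTop.eventually h1] with n hn
    simp only [id, Real.norm_eq_abs, Nat.abs_cast] at hn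
    exact (le_abs_self _).trans hn
  have hE5 : ∀ᶠ n : ℕ in atTop, Real.log (n : ℝ) ≤ Real.sqrt n / 2 := by
    have h1 := (isLittleO_log_rpow_atTop (show (0 : ℝ) < 1 / 2 by norm_num)).bound
      (show (0 : ℝ) < 1 / 2 by norm_num)
    filter_upwards [tendsto_natCast_atTop_atTop.eventually h1] with n hn
    rw [← Real.sqrt_eq_rpow, Real.norm_eq_abs, Real.norm_eq_abs,
      abs_of_nonneg (Real.sqrt_nonneg _)] at hn
    linarith [le_abs_self (Real.log (n : ℝ))]
  filter_upwards [hS.eventually hx, hE2, hE5, ha.bound (show (0 : ℝ) < 1 / 4 by norm_num),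
    hL.eventually_ge_atTop 1, eventually_ge_atTop 3] with n h3 h2 h5 h4 hL1 hn3
  have hnpos : (0 : ℝ) < n := by positivity
  have hA : (1 : ℝ) ≤ a n := by exact_mod_cast ha1 n
  rw [Real.norm_eq_abs, Real.norm_eq_abs, Nat.abs_cast, abs_of_nonneg (Real.sqrt_nonneg _)] at h4
  have hk0 : (0 : ℝ) ≤ k n := Nat.cast_nonneg _
  have hsq := Real.mul_self_sqrt hnpos.le
  have hsp := Real.sqrt_pos.2 hnpos
  have hlo : (n : ℝ) / (2 * ((a n : ℝ) + Real.log n)) ≤ cliqueSize a n := Nat.le_ceil _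
  have hSpos : (0 : ℝ) < (a n : ℝ) + Real.log n := by linarith
  have hhn : cliqueSize a n ≤ n := by
    apply Nat.ceil_le.2
    apply div_le_self hnpos.le
    linarith
  generalize hh : cliqueSize a n = h at *
  generalize hLL : Real.log (n : ℝ) = L at *
  have hbig : 4 * (a n : ℝ) * (a n + L) < n := by nlinarith
  rw [div_le_iff₀ (by positivity)] at hlo
  have h2a : 2 * (a n : ℝ) < h := by
    by_contra hcon
    push Not at hcon
    nlinarith
  have h2a' : 2 * a n < h := by exact_mod_cast h2a
  have hlt : a n < h - a n := by omega
  refine ⟨hlt, ?_⟩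
  rw [Nat.cast_sub (by omega : a n ≤ h)]
  have hapos : (0 : ℝ) < a n := by linarith
  have hcl : ((h : ℝ) - a n) / a n ≤ (⌈((h : ℝ) - a n) / a n⌉₊ : ℝ) := Nat.le_ceil _
  have hcu : (⌈((h : ℝ) - a n) / a n⌉₊ : ℝ) ≤ n := by
    have : ⌈((h : ℝ) - a n) / a n⌉₊ ≤ n := by
      apply Nat.ceil_le.2
      have hhn' : (h : ℝ) ≤ n := by exact_mod_cast hhn
      exact (div_le_self (by linarith) hA).trans (by linarith)
    exact_mod_cast this
  generalize (⌈((h : ℝ) - a n) / a n⌉₊ : ℝ) = c at *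
  have hq1 : (a n : ℝ) / ((h : ℝ) - a n) ≤ 1 := by
    rw [div_le_one (by linarith)]; linarith
  have hq0 : 0 ≤ (a n : ℝ) / ((h : ℝ) - a n) := div_nonneg hapos.le (by linarith)
  generalize (a n : ℝ) / ((h : ℝ) - a n) = q at *
  rw [div_le_iff₀ hapos] at hcl
  have hc1 : 0 < c := by
    by_contra hcon
    push Not at hcon
    nlinarith
  have hlu : Real.log c ≤ L := hLL ▸ Real.log_le_log hc1 hcu
  have hll : L - Real.log (4 * (a n + L) ^ 2) ≤ Real.log c := by
    have hp : (0 : ℝ) < 4 * (a n + L) ^ 2 := by positivity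
    rw [← hLL, hLL, ← hLL, ← Real.log_div hnpos.ne' (by rw [hLL]; exact hp.ne'), hLL]
    apply Real.log_le_log (by positivity)
    rw [div_le_iff₀ hp]
    have e1 : (h : ℝ) ≤ 2 * (c * a n) := by linarith
    have e2 : (n : ℝ) ≤ 2 * (c * a n) * (2 * (a n + L)) :=
      hlo.trans (mul_le_mul_of_nonneg_right e1 (by positivity))
    have e3 : c * (a n * (a n + L)) ≤ c * ((a n + L) * (a n + L)) := by
      gcongr
      linarith
    nlinarith
  generalize Real.log c = l at *
  have hD : (1 - δ) * (a n + L) ≤ a n + l - 1 + q := by linarith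
  have hDp : 0 < (1 - δ) * (a n + L) := mul_pos (by linarith) hSpos
  have hh0 : (0 : ℝ) ≤ h := Nat.cast_nonneg _
  have hN : (a n : ℝ) * ((n : ℝ) - k n - h + l) + l - 1 + q ≤ (1 + δ) * (a n * n) := by
    have e1 : (a n : ℝ) * ((n : ℝ) - k n - h + l) ≤ a n * (n + L) := by
      gcongr
      linarith
    have e2 : L ≤ a n * L := by nlinarith
    have e3 : (a n : ℝ) * L ≤ a n * (δ / 2 * n) := by gcongr
    nlinarith
  rw [ge_iff_le, div_le_div_iff₀ (by linarith) hSpos]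
  have hAN : (0 : ℝ) ≤ a n * n := by positivity
  calc _ ≤ (1 + δ) * (a n * n) * (a n + L) := by gcongr
    _ ≤ (1 + ε) * (1 - δ) * (a n * n) * (a n + L) := by gcongr
    _ = (1 + ε) * a n * n * ((1 - δ) * (a n + L)) := by ring
    _ ≤ _ := by gcongr
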